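/- Let λ = (√5 − 1)/2, let θ ∈ (0,1), and define a_n = 1 if the fractional part {λ n} < θ and a_n = 0 otherwise. Then: (i) there is a constant C such that |A(x;q,b) − θ x / q| ≤ C x^{2/3} for all real x ≥ 1 and all integers q ≥ 1, 1 ≤ b ≤ q (i.e. the approximation hypothesis holds with f(q,r) = θ/q and Ψ(x) = x^{1/3}); (ii) Σ_{q=1}^∞ g(q) = θ², where g(q) = φ(q) (Σ_{r | q} (θ/q) μ(q/r))²; and (iii) Σ_{n ≤ x} a_n² = θ x + O(x^{2/3}). -/

import Mathlib

open Classical Finset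

/-- The golden-ratio-like constant λ = (√5 − 1)/2. -/
noncomputable def lam : ℝ := (Real.sqrt 5 - 1) / 2

/-- `a_n = 1` if `{λn} < θ` and `0` otherwise. -/
noncomputable def aBeatty (θ : ℝ) (n : ℕ) : ℝ :=
  if Int.fract (lam * n) < θ then 1 else 0

/-- `A(x;q,b) = Σ_{n ≤ x, n ≡ b (mod q)} a_n`. -/
noncomputable def Aseq (a : ℕ → ℝ) (x : ℝ) (q b : ℕ) : ℝ :=
  ∑ n ∈ (Finset.Icc 1 ⌊x⌋₊).filter (fun n => n % q = b % q), a n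

/-- `g(q) = φ(q) (Σ_{r | q} f(q,r) μ(q/r))²` with `f(q,r) = θ/q`. -/
noncomputable def gBeatty (θ : ℝ) (q : ℕ) : ℝ :=
  (Nat.totient q : ℝ) *
    (∑ r ∈ q.divisors, (θ / q) * ((ArithmeticFunction.moebius (q / r) : ℤ) : ℝ)) ^ 2

theorem ite_fract_lt_eq_floor_sub_floor {θ : ℝ} (hθ0 : 0 < θ) (hθ1 : θ < 1) (t : ℝ) :
    (if Int.fract t < θ then (1 : ℝ) else 0) = ((⌊t⌋ - ⌊t - θ⌋ : ℤ) : ℝ) := by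
  have h0 := Int.fract_nonneg t
  have h1 := Int.fract_lt_one t
  have h2 := Int.floor_add_fract t
  split_ifs with h
  · have : ⌊t - θ⌋ = ⌊t⌋ - 1 := by
      rw [Int.floor_eq_iff]
      push_cast
      constructor <;> linarith
    rw [this]
    push_cast
    ring
  · have : ⌊t - θ⌋ = ⌊t⌋ := by
      rw [Int.floor_eq_iff]
      push Not at h
      constructor <;> linarith
    rw [this]
    simp

/-- Among `a m + s` with `m` in a complete residue system, exactly one is divisible by `r`. -/
theorem card_filter_dvd_mul_add {a : ℤ} {r : ℕ} (hr : 0 < r) (hc : IsCoprime a (r : ℤ)) (s : ℤ) :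
    ((Finset.range r).filter fun m : ℕ => (r : ℤ) ∣ a * m + s).card = 1 := by
  have hr' : (0 : ℤ) < r := by exact_mod_cast hr
  obtain ⟨u, v, huv⟩ := hc
  rw [Finset.card_eq_one]
  refine ⟨((-u * s) % r).toNat, ?_⟩
  have hnn : 0 ≤ (-u * s) % (r : ℤ) := Int.emod_nonneg _ hr'.ne'
  have hlt : (-u * s) % (r : ℤ) < r := Int.emod_lt_of_pos _ hr'
  ext m
  simp only [Finset.mem_filter, Finset.mem_range, Finset.mem_singleton]
  constructor
  · rintro ⟨hm, k, hk⟩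
    have h : (-u * s) % (r : ℤ) = m := by
      have h' : -u * s = m + r * (-u * k - v * m) := by
        linear_combination (-u) * hk + (m : ℤ) * huv
      rw [h', Int.add_mul_emod_self_left]
      exact Int.emod_eq_of_lt (by positivity) (by exact_mod_cast hm)
    omega
  · intro hm
    refine ⟨by omega, ?_⟩
    have hm' : (m : ℤ) = (-u * s) % (r : ℤ) := by omega
    have hd := Int.emod_add_mul_ediv (-u * s) r
    rw [← hm'] at hd
    refine ⟨v * s - a * ((-u * s) / r), ?_⟩
    linear_combination a * hd - s * huv

theorem add_one_ediv_natCast {r : ℕ} (hr : 0 < r) (k : ℤ) :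
    (k + 1) / (r : ℤ) = k / r + if (r : ℤ) ∣ k + 1 then 1 else 0 := by
  have hr' : (0 : ℤ) < r := by exact_mod_cast hr
  have hd := Int.emod_add_mul_ediv k r
  have hnn : 0 ≤ k % (r : ℤ) := Int.emod_nonneg _ hr'.ne'
  have hlt : k % (r : ℤ) < r := Int.emod_lt_of_pos _ hr'
  split_ifs with h
  · obtain ⟨c, hc⟩ := h
    rw [hc, Int.mul_ediv_cancel_left _ hr'.ne']
    have h1 : (r : ℤ) * (c - k / r - 1) < r * 1 := by linarith
    have h2 : (r : ℤ) * (-1) < r * (c - k / r - 1) := by linarith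
    have := lt_of_mul_lt_mul_left h1 hr'.le
    have := lt_of_mul_lt_mul_left h2 hr'.le
    omega
  · have hne : k % (r : ℤ) + 1 ≠ r := by
      intro he
      exact h ⟨k / r + 1, by linear_combination he - hd⟩
    have h3 : k + 1 = (k % (r : ℤ) + 1) + r * (k / r) := by linarith
    conv_lhs => rw [h3]
    rw [Int.add_mul_ediv_left _ _ hr'.ne', Int.ediv_eq_zero_of_lt (by omega) (by omega)]
    ring

/-- Hermite's identity, with the residues permuted by multiplication by a unit. -/
theorem sum_ediv_mul_add {a : ℤ} {r : ℕ} (hr : 0 < r) (hc : IsCoprime a (r : ℤ)) (s : ℤ) :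
    ∑ m ∈ Finset.range r, (a * m + s) / (r : ℤ) = ∑ m ∈ Finset.range r, a * m / (r : ℤ) + s := by
  have step : ∀ s : ℤ, ∑ m ∈ Finset.range r, (a * m + (s + 1)) / (r : ℤ) =
      ∑ m ∈ Finset.range r, (a * m + s) / (r : ℤ) + 1 := by
    intro s
    simp_rw [← add_assoc, add_one_ediv_natCast hr, Finset.sum_add_distrib]
    congr 1
    rw [← Finset.sum_filter]
    have := card_filter_dvd_mul_add hr hc (s + 1)
    simp_rw [← add_assoc] at this
    simp [this]
  induction s using Int.induction_on with
  | zero => simp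
  | succ i ih => rw [step, ih, add_assoc]
  | pred i ih =>
    have := step (-(i : ℤ) - 1)
    rw [sub_add_cancel, ih] at this
    linarith

theorem sum_floor_div_add {a : ℤ} {r : ℕ} (hr : 0 < r) (hc : IsCoprime a (r : ℤ)) (γ : ℝ) :
    ∑ m ∈ Finset.range r, ⌊((a * m : ℤ) : ℝ) / r + γ⌋ =
      ∑ m ∈ Finset.range r, a * m / (r : ℤ) + ⌊r * γ⌋ := by
  have hr' : (r : ℝ) ≠ 0 := by positivity
  rw [← sum_ediv_mul_add hr hc]
  refine Finset.sum_congr rfl fun m _ => ?_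
  have : ((a * m : ℤ) : ℝ) / r + γ = (((a * m : ℤ) : ℝ) + r * γ) / r := by field_simp
  rw [this, Int.floor_div_natCast, Int.floor_intCast_add]

/-- Over a block of length the denominator of a good rational approximation to `α`, the
points `α m + β` modulo one hit `[0, θ)` as often as expected, up to a bounded error. -/
theorem abs_sum_floor_sub_floor_sub_le {α : ℝ} {a : ℤ} {r : ℕ} (hr : 0 < r)
    (hc : IsCoprime a (r : ℤ)) (hα : |α - a / r| ≤ 1 / (r : ℝ) ^ 2) (β θ : ℝ) :
    |∑ m ∈ Finset.range r, ((⌊α * m + β⌋ - ⌊α * m + β - θ⌋ : ℤ) : ℝ) - θ * r| ≤ 3 := by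
  have hr' : (0 : ℝ) < r := by positivity
  have close : ∀ m ∈ Finset.range r, |α * m - ((a * m : ℤ) : ℝ) / r| ≤ 1 / r := by
    intro m hm
    have hm' : (m : ℝ) ≤ r := by exact_mod_cast (Finset.mem_range.mp hm).le
    have : α * m - ((a * m : ℤ) : ℝ) / r = (α - a / r) * m := by
      push_cast
      ring
    rw [this, abs_mul, Nat.abs_cast]
    calc |α - a / r| * m ≤ 1 / (r : ℝ) ^ 2 * r := by gcongr
      _ = 1 / r := by field_simp
  have upper : ∀ γ : ℝ, ((∑ m ∈ Finset.range r, ⌊α * m + γ⌋ : ℤ) : ℝ) ≤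
      ((∑ m ∈ Finset.range r, a * m / (r : ℤ) : ℤ) : ℝ) + (r * γ + 1) := by
    intro γ
    have h : ∑ m ∈ Finset.range r, ⌊α * m + γ⌋ ≤
        ∑ m ∈ Finset.range r, ⌊((a * m : ℤ) : ℝ) / r + (γ + 1 / r)⌋ := by
      refine Finset.sum_le_sum fun m hm => Int.floor_le_floor ?_
      linarith [(abs_le.mp (close m hm)).2]
    rw [sum_floor_div_add hr hc] at h
    have h' := Int.floor_le ((r : ℝ) * (γ + 1 / r))
    have he : (r : ℝ) * (γ + 1 / r) = r * γ + 1 := by field_simp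
    have h'' : ((∑ m ∈ Finset.range r, ⌊α * m + γ⌋ : ℤ) : ℝ) ≤ _ := Int.cast_le.mpr h
    rw [Int.cast_add] at h''
    linarith
  have lower : ∀ γ : ℝ, ((∑ m ∈ Finset.range r, a * m / (r : ℤ) : ℤ) : ℝ) + (r * γ - 2) ≤
      ((∑ m ∈ Finset.range r, ⌊α * m + γ⌋ : ℤ) : ℝ) := by
    intro γ
    have h : ∑ m ∈ Finset.range r, ⌊((a * m : ℤ) : ℝ) / r + (γ - 1 / r)⌋ ≤
        ∑ m ∈ Finset.range r, ⌊α * m + γ⌋ := by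
      refine Finset.sum_le_sum fun m hm => Int.floor_le_floor ?_
      linarith [(abs_le.mp (close m hm)).1]
    rw [sum_floor_div_add hr hc] at h
    have h' := Int.lt_floor_add_one ((r : ℝ) * (γ - 1 / r))
    have he : (r : ℝ) * (γ - 1 / r) = r * γ - 1 := by field_simp
    have h'' : _ ≤ ((∑ m ∈ Finset.range r, ⌊α * m + γ⌋ : ℤ) : ℝ) := Int.cast_le.mpr h
    rw [Int.cast_add] at h''
    linarith
  have u1 := upper β
  have u2 := upper (β - θ)
  have l1 := lower β
  have l2 := lower (β - θ)
  simp_rw [add_sub_assoc, ← Int.cast_sum, Finset.sum_sub_distrib, Int.cast_sub]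
  rw [abs_le]
  constructor <;> nlinarith

theorem abs_sum_range_sub_le_of_blocks {f : ℕ → ℝ} {θ c : ℝ} {r : ℕ} (hr : 0 < r) (hc : 0 ≤ c)
    (hf : ∀ m, |f m - θ| ≤ 1)
    (hblock : ∀ k, |∑ m ∈ Finset.range r, f (k + m) - θ * r| ≤ c) (N : ℕ) :
    |∑ m ∈ Finset.range N, f m - θ * N| ≤ c * (N / r) + r := by
  have hr' : (0 : ℝ) < r := by positivity
  have full : ∀ t : ℕ, |∑ m ∈ Finset.range (r * t), f m - θ * (r * t)| ≤ c * t := by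
    intro t
    induction t with
    | zero => simp
    | succ t ih =>
      rw [Nat.mul_succ, Finset.sum_range_add]
      have h := abs_add_le (∑ m ∈ Finset.range (r * t), f m - θ * (r * t))
        (∑ m ∈ Finset.range r, f (r * t + m) - θ * r)
      have h2 := hblock (r * t)
      push_cast
      rw [show ∀ x y : ℝ, x + y - θ * (r * (t + 1)) = x - θ * (r * t) + (y - θ * r) by
        intros; ring]
      linarith
  have rest : |∑ m ∈ Finset.range (N % r), f (r * (N / r) + m) - θ * (N % r : ℕ)| ≤ r := by
    calc |∑ m ∈ Finset.range (N % r), f (r * (N / r) + m) - θ * (N % r : ℕ)|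
        = |∑ m ∈ Finset.range (N % r), (f (r * (N / r) + m) - θ)| := by
          simp [Finset.sum_sub_distrib, mul_comm]
      _ ≤ ∑ m ∈ Finset.range (N % r), |f (r * (N / r) + m) - θ| := Finset.abs_sum_le_sum_abs _ _
      _ ≤ ∑ m ∈ Finset.range (N % r), 1 := Finset.sum_le_sum fun m _ => hf _
      _ = (N % r : ℕ) := by simp
      _ ≤ r := by exact_mod_cast (Nat.mod_lt N hr).le
  have hN : r * (N / r) + N % r = N := Nat.div_add_mod N r
  have hN' : (r : ℝ) * (N / r : ℕ) + (N % r : ℕ) = N := by exact_mod_cast hN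
  have hdiv : ((N / r : ℕ) : ℝ) ≤ N / r := Nat.cast_div_le
  have h1 := full (N / r)
  have h2 : ∑ m ∈ Finset.range N, f m = ∑ m ∈ Finset.range (r * (N / r)), f m +
      ∑ m ∈ Finset.range (N % r), f (r * (N / r) + m) := by
    rw [← Finset.sum_range_add, hN]
  have h3 := abs_add_le (∑ m ∈ Finset.range (r * (N / r)), f m - θ * (r * (N / r : ℕ)))
    (∑ m ∈ Finset.range (N % r), f (r * (N / r) + m) - θ * (N % r : ℕ))
  have h4 : ∑ m ∈ Finset.range N, f m - θ * N =
      (∑ m ∈ Finset.range (r * (N / r)), f m - θ * (r * (N / r : ℕ))) +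
      (∑ m ∈ Finset.range (N % r), f (r * (N / r) + m) - θ * (N % r : ℕ)) := by
    rw [h2]
    linear_combination θ * hN'
  rw [h4]
  have h5 := mul_le_mul_of_nonneg_left hdiv hc
  linarith

/-- The number `λ` is badly approximable. -/
theorem one_le_mul_abs_lam_mul_sub {k : ℕ} (hk : 0 < k) (a : ℤ) (h : |lam * k - a| ≤ 1) :
    1 ≤ 4 * k * |lam * k - a| := by
  have hs : Real.sqrt 5 ^ 2 = 5 := Real.sq_sqrt (by norm_num)
  have hs0 : 0 ≤ Real.sqrt 5 := Real.sqrt_nonneg 5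
  have hs3 : Real.sqrt 5 ≤ 3 := by nlinarith
  have hk1 : (1 : ℝ) ≤ k := by exact_mod_cast hk
  have hprod : (lam * k - a) * (lam * k - a - Real.sqrt 5 * k) =
      ((a ^ 2 + a * k - k ^ 2 : ℤ) : ℝ) := by
    unfold lam
    push_cast
    linear_combination (-(k : ℝ) ^ 2 / 4) * hs
  have hne : (a ^ 2 + a * k - (k : ℤ) ^ 2 : ℤ) ≠ 0 := by
    intro h0
    have hirr : Irrational (Real.sqrt 5) := by
      exact_mod_cast (show Nat.Prime 5 by norm_num).irrational_sqrt
    have hk0 : (k : ℝ) ≠ 0 := by positivity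
    have hsq : ((a : ℝ)) ^ 2 + a * k - (k : ℝ) ^ 2 = 0 := by exact_mod_cast h0
    apply hirr
    refine ⟨|(2 * a + k) / k|, ?_⟩
    push_cast
    rw [← Real.sqrt_sq_eq_abs]
    congr 1
    field_simp
    linear_combination 4 * hsq
  have habs : 1 ≤ |lam * k - a| * |lam * k - a - Real.sqrt 5 * k| := by
    rw [← abs_mul, hprod, ← Int.cast_abs]
    exact_mod_cast Int.one_le_abs hne
  have hle : |lam * k - a - Real.sqrt 5 * k| ≤ 4 * k := by
    obtain ⟨h1, h2⟩ := abs_le.mp h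
    rw [abs_le]
    constructor <;> nlinarith
  nlinarith [abs_nonneg (lam * k - a)]

theorem aBeatty_nonneg (θ : ℝ) (n : ℕ) : 0 ≤ aBeatty θ n := by
  unfold aBeatty
  split_ifs <;> norm_num

theorem aBeatty_le_one (θ : ℝ) (n : ℕ) : aBeatty θ n ≤ 1 := by
  unfold aBeatty
  split_ifs <;> norm_num

/-- Discrepancy of `λ n` along an arithmetic progression; `R` is the Dirichlet parameter. -/
theorem abs_sum_aBeatty_sub_le {θ : ℝ} (hθ0 : 0 < θ) (hθ1 : θ < 1) {q : ℕ} (hq : 0 < q) (b N : ℕ)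
    {R : ℕ} (hR : 0 < R) :
    ∃ r : ℕ, 0 < r ∧ r ≤ R ∧ R + 1 ≤ 4 * r * q ∧
      |∑ m ∈ Finset.range N, aBeatty θ (b + q * m) - θ * N| ≤ 3 * (N / r) + r := by
  obtain ⟨p, hp, hpR⟩ := Real.exists_rat_abs_sub_le_and_den_le (lam * q) hR
  have hr : 0 < p.den := p.pos
  have hr' : (0 : ℝ) < p.den := by exact_mod_cast hr
  have hR' : (p.den : ℝ) ≤ R := by exact_mod_cast hpR
  have hR1 : (1 : ℝ) ≤ R := by exact_mod_cast hR
  rw [Rat.cast_def] at hp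
  refine ⟨p.den, hr, hpR, ?_, ?_⟩
  · have hk : |lam * (p.den * q : ℕ) - p.num| ≤ 1 / (R + 1) := by
      have : lam * (p.den * q : ℕ) - p.num = p.den * (lam * q - p.num / p.den) := by
        push_cast
        field_simp
      rw [this, abs_mul, Nat.abs_cast]
      calc (p.den : ℝ) * |lam * q - p.num / p.den| ≤ p.den * (1 / ((R + 1) * p.den)) := by gcongr
        _ = 1 / (R + 1) := by field_simp
    have h1 : (1 : ℝ) / (R + 1) ≤ 1 := by
      rw [div_le_one (by positivity)]
      linarith
    have h2 := one_le_mul_abs_lam_mul_sub (Nat.mul_pos hr hq) p.num (hk.trans h1)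
    have h3 : (1 : ℝ) ≤ 4 * (p.den * q : ℕ) * (1 / (R + 1)) :=
      h2.trans (by gcongr)
    rw [mul_one_div, le_div_iff₀ (by positivity), one_mul] at h3
    rw [mul_assoc]
    exact_mod_cast h3
  · refine abs_sum_range_sub_le_of_blocks hr (by norm_num) (fun m => ?_) (fun k => ?_) N
    · rw [abs_le]
      constructor <;> linarith [aBeatty_nonneg θ (b + q * m), aBeatty_le_one θ (b + q * m)]
    · have hc : IsCoprime p.num (p.den : ℤ) := by
        rw [Int.isCoprime_iff_gcd_eq_one]
        exact p.reduced
      have hα : |lam * q - p.num / p.den| ≤ 1 / (p.den : ℝ) ^ 2 := by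
        refine hp.trans ?_
        rw [sq]
        gcongr
        linarith
      have h := abs_sum_floor_sub_floor_sub_le hr hc hα (lam * (b + q * k)) θ
      convert h using 4 with m
      rw [aBeatty, ← ite_fract_lt_eq_floor_sub_floor hθ0 hθ1]
      have : lam * ((b + q * (k + m) : ℕ) : ℝ) = lam * q * m + lam * (b + q * k) := by
        push_cast
        ring
      rw [this]

theorem Aseq_eq_sum_range (a : ℕ → ℝ) (x : ℝ) {q b : ℕ} (hq : 0 < q) (hb : 1 ≤ b) (hbq : b ≤ q) :
    Aseq a x q b = ∑ m ∈ Finset.range ((⌊x⌋₊ + q - b) / q), a (b + q * m) := by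
  have key : ∀ m, m < (⌊x⌋₊ + q - b) / q ↔ b + q * m ≤ ⌊x⌋₊ := by
    intro m
    rw [← Nat.succ_le_iff, Nat.le_div_iff_mul_le hq, Nat.succ_mul, mul_comm]
    omega
  unfold Aseq
  symm
  refine Finset.sum_bij (fun m _ => b + q * m) ?_ ?_ ?_ ?_
  · intro m hm
    simp only [Finset.mem_filter, Finset.mem_Icc, Nat.add_mul_mod_self_left, and_true]
    exact ⟨by omega, (key m).mp (Finset.mem_range.mp hm)⟩
  · intro m _ m' _ h
    exact Nat.eq_of_mul_eq_mul_left hq (Nat.add_left_cancel h)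
  · intro n hn
    simp only [Finset.mem_filter, Finset.mem_Icc] at hn
    obtain ⟨⟨hn1, hnx⟩, hmod⟩ := hn
    have hbn : b ≤ n := by
      by_contra! hlt
      have h1 : n % q = n := Nat.mod_eq_of_lt (by omega)
      rcases hbq.lt_or_eq with h | h
      · rw [h1, Nat.mod_eq_of_lt h] at hmod
        omega
      · rw [h1, h, Nat.mod_self] at hmod
        omega
    obtain ⟨m, hm⟩ := (Nat.modEq_iff_dvd' hbn).mp hmod.symm
    refine ⟨m, ?_, by omega⟩
    rw [Finset.mem_range, key]
    omega
  · intros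
    rfl

theorem abs_Aseq_aBeatty_sub_le {θ : ℝ} (hθ0 : 0 < θ) (hθ1 : θ < 1) {x : ℝ} (hx : 1 ≤ x)
    {q b : ℕ} (hq : 1 ≤ q) (hb : 1 ≤ b) (hbq : b ≤ q) :
    |Aseq (aBeatty θ) x q b - θ * x / q| ≤ 17 * x ^ ((2 : ℝ) / 3) := by
  have hx0 : 0 ≤ x := by linarith
  have hsx : 1 ≤ Real.sqrt x := Real.one_le_sqrt.mpr hx
  have hss : Real.sqrt x * Real.sqrt x = x := Real.mul_self_sqrt hx0
  have hpow : Real.sqrt x ≤ x ^ ((2 : ℝ) / 3) := by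
    rw [Real.sqrt_eq_rpow]
    exact Real.rpow_le_rpow_of_exponent_le hx (by norm_num)
  have hR : 0 < ⌊Real.sqrt x⌋₊ := Nat.floor_pos.mpr hsx
  have hRle : (⌊Real.sqrt x⌋₊ : ℝ) ≤ Real.sqrt x := Nat.floor_le (by positivity)
  have hRlt : Real.sqrt x < ⌊Real.sqrt x⌋₊ + 1 := Nat.lt_floor_add_one _
  rw [Aseq_eq_sum_range _ _ hq hb hbq]
  set N := (⌊x⌋₊ + q - b) / q with hN
  obtain ⟨r, hr, hrR, hRr, hmain⟩ := abs_sum_aBeatty_sub_le hθ0 hθ1 hq b N hR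
  have hq' : (1 : ℝ) ≤ q := by exact_mod_cast hq
  have hr' : (1 : ℝ) ≤ r := by exact_mod_cast hr
  have hrR' : (r : ℝ) ≤ ⌊Real.sqrt x⌋₊ := by exact_mod_cast hrR
  have hRr' : (⌊Real.sqrt x⌋₊ : ℝ) + 1 ≤ 4 * r * q := by exact_mod_cast hRr
  have hfl : (⌊x⌋₊ : ℝ) ≤ x := Nat.floor_le hx0
  have hfl' : x < ⌊x⌋₊ + 1 := Nat.lt_floor_add_one x
  have hNu : (N : ℝ) * q ≤ x + q := by
    have h1 : N * q ≤ ⌊x⌋₊ + q := (Nat.div_mul_le_self _ _).trans (Nat.sub_le _ _)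
    have h2 : (N : ℝ) * q ≤ ⌊x⌋₊ + q := by exact_mod_cast h1
    linarith
  have hNl : x - q ≤ (N : ℝ) * q := by
    have h1 : ⌊x⌋₊ + q - b < N * q + q := Nat.lt_div_mul_add hq
    have h2 : ⌊x⌋₊ + 1 ≤ N * q + q := by omega
    have h3 : (⌊x⌋₊ : ℝ) + 1 ≤ N * q + q := by exact_mod_cast h2
    linarith
  have hNdiff : |(N : ℝ) - x / q| ≤ 1 := by
    have : (N : ℝ) - x / q = (N * q - x) / q := by field_simp
    rw [this, abs_div, Nat.abs_cast, div_le_one (by linarith), abs_le]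
    constructor <;> linarith
  have hNr : (N : ℝ) / r ≤ 4 * Real.sqrt x + 1 := by
    rw [div_le_iff₀ (by linarith)]
    have h1 : Real.sqrt x * Real.sqrt x ≤ Real.sqrt x * (4 * r * q) := by
      gcongr
      linarith
    have h2 : (q : ℝ) ≤ r * q := by nlinarith
    have h3 : (N : ℝ) * q ≤ ((4 * Real.sqrt x + 1) * r) * q := by nlinarith
    exact le_of_mul_le_mul_right h3 (by linarith)
  have hθN : |θ * N - θ * x / q| ≤ 1 := by
    rw [mul_div_assoc, ← mul_sub, abs_mul, abs_of_pos hθ0]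
    nlinarith [abs_nonneg ((N : ℝ) - x / q)]
  have htri := abs_sub_le (∑ m ∈ Finset.range N, aBeatty θ (b + q * m)) (θ * N) (θ * x / q)
  linarith

theorem gBeatty_one (θ : ℝ) : gBeatty θ 1 = θ ^ 2 := by
  simp [gBeatty]

theorem gBeatty_of_ne_one (θ : ℝ) {q : ℕ} (hq : q ≠ 1) : gBeatty θ q = 0 := by
  have h : ∑ r ∈ q.divisors, ArithmeticFunction.moebius (q / r) = 0 := by
    rw [Nat.sum_div_divisors q fun d => ArithmeticFunction.moebius d,
      ← ArithmeticFunction.coe_mul_zeta_apply, ArithmeticFunction.moebius_mul_coe_zeta,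
      ArithmeticFunction.one_apply_ne hq]
  rw [gBeatty, ← Finset.mul_sum, ← Int.cast_sum, h]
  simp

theorem Aseq_one_one (a : ℕ → ℝ) (x : ℝ) : Aseq a x 1 1 = ∑ n ∈ Finset.Icc 1 ⌊x⌋₊, a n := by
  simp [Aseq, Nat.mod_one]

theorem aBeatty_sq (θ : ℝ) (n : ℕ) : aBeatty θ n ^ 2 = aBeatty θ n := by
  unfold aBeatty
  split_ifs <;> norm_num

/-- Vaughan (1998), Theorem 3: for the sequence `a_n = 1_{{λn} < θ}` the
approximation hypothesis holds with `f(q,(q,b)) = θ/q` and `Ψ(x) = x^{1/3}`,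
one has `Σ g(q) = θ²`, yet `Σ_{n ≤ x} a_n² = θx + O(x^{2/3})`. -/
theorem vaughan_beatty_example (θ : ℝ) (hθ0 : 0 < θ) (hθ1 : θ < 1) :
    (∃ C : ℝ, 0 < C ∧ ∀ x : ℝ, 1 ≤ x → ∀ q b : ℕ, 1 ≤ q → 1 ≤ b → b ≤ q →
      |Aseq (aBeatty θ) x q b - θ * x / q| ≤ C * x ^ ((2 : ℝ) / 3)) ∧
    (∑' q : ℕ, gBeatty θ q) = θ ^ 2 ∧
    (∃ C : ℝ, 0 < C ∧ ∀ x : ℝ, 1 ≤ x →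
      |(∑ n ∈ Finset.Icc 1 ⌊x⌋₊, aBeatty θ n ^ 2) - θ * x| ≤ C * x ^ ((2 : ℝ) / 3)) := by
  refine ⟨⟨17, by norm_num, fun x hx q b hq hb hbq =>
    abs_Aseq_aBeatty_sub_le hθ0 hθ1 hx hq hb hbq⟩, ?_, 17, by norm_num, fun x hx => ?_⟩
  · rw [tsum_eq_single 1 fun q hq => gBeatty_of_ne_one θ hq, gBeatty_one]
  · have h := abs_Aseq_aBeatty_sub_le hθ0 hθ1 hx le_rfl le_rfl (le_refl 1)
    rw [Aseq_one_one] at h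
    simpa [aBeatty_sq] using h
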